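/- Let (X,d) be a nonempty compact metric space, f : X → X a continuous, open, distance expanding, topologically transitive map, and φ : X → ℝ Hölder continuous. Then there exist λ > 0 and a Borel probability measure m on X such that ∫_X (L_φ g) dm = λ·∫_X g dm for every continuous function g : X → ℝ, where (L_φ g)(x) = Σ_{y ∈ f^{−1}(x)} g(y)·e^{φ(y)}. That is, m is a fixed point (up to the normalizing eigenvalue λ) of the operator dual to the transfer operator L_φ. -/

import Mathlib

open MeasureTheory Filter Metric Set

/-- `f` is distance expanding: there are `lam > 1` and `η > 0` with
`dist (f x) (f y) ≥ lam * dist x y` whenever `dist x y ≤ η`. -/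
def DistanceExpanding {X : Type*} [MetricSpace X] (f : X → X) : Prop :=
  ∃ lam > (1 : ℝ), ∃ η > (0 : ℝ), ∀ x y : X, dist x y ≤ η →
    lam * dist x y ≤ dist (f x) (f y)

/-- `f` is topologically transitive: for all nonempty open `U, V` there is
`n ≥ 0` with `f^[n] '' U ∩ V ≠ ∅`. -/
def TopologicallyTransitive {X : Type*} [TopologicalSpace X] (f : X → X) : Prop :=
  ∀ U V : Set X, IsOpen U → IsOpen V → U.Nonempty → V.Nonempty →
    ∃ n : ℕ, (f^[n] '' U ∩ V).Nonempty

/-- `φ` is Hölder continuous: `|φ x - φ y| ≤ C * dist x y ^ b` for some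
`C > 0` and `b ∈ (0, 1]`. -/
def HolderPotential {X : Type*} [MetricSpace X] (φ : X → ℝ) : Prop :=
  ∃ C > (0 : ℝ), ∃ b ∈ Set.Ioc (0 : ℝ) 1, ∀ x y : X, |φ x - φ y| ≤ C * dist x y ^ b

/-- Birkhoff sum `S_n φ (x) = ∑_{j<n} φ (f^j x)`. -/
def birkhoffSum' {X : Type*} (f : X → X) (φ : X → ℝ) (n : ℕ) (x : X) : ℝ :=
  ∑ j ∈ Finset.range n, φ (f^[j] x)

/-- The Bowen ball `B_n(x, r) = {y : dist (f^j x) (f^j y) < r for all 0 ≤ j ≤ n}`. -/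
def bowenBall {X : Type*} [MetricSpace X] (f : X → X) (n : ℕ) (x : X) (r : ℝ) : Set X :=
  {y | ∀ j ≤ n, dist (f^[j] x) (f^[j] y) < r}

/-- The `n`-th level tree sum `∑_{x ∈ f^{-n}(x₀)} exp (S_n φ (x))`
(a `tsum` over the fiber, which is finite in the situations considered). -/
noncomputable def treeSum {X : Type*} (f : X → X) (φ : X → ℝ) (n : ℕ) (x₀ : X) : ℝ :=
  ∑' x : (f^[n] ⁻¹' {x₀} : Set X), Real.exp (birkhoffSum' f φ n x)

/-- The transfer (Perron–Frobenius–Ruelle) operator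
`(L_φ g)(x) = ∑_{y ∈ f⁻¹(x)} g(y) e^{φ(y)}`
(a `tsum` over the fiber, which is finite in the situations considered). -/
noncomputable def transferOp {X : Type*} (f : X → X) (φ : X → ℝ) (g : X → ℝ) (x : X) : ℝ :=
  ∑' y : (f ⁻¹' {x} : Set X), g y * Real.exp (φ y)

/-- A positive operator on `C(X)` has a positive normalized dual eigenfunctional. -/
theorem positive_dual_eigen {X : Type*} [TopologicalSpace X] [CompactSpace X] [Nonempty X]
    (L : C(X, ℝ) →ₗ[ℝ] C(X, ℝ)) (hL : ∀ g : C(X, ℝ), (∀ x, 0 ≤ g x) → ∀ x, 0 ≤ L g x) :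
    ∃ (r : ℝ) (Λ : C(X, ℝ) →ₗ[ℝ] ℝ), (∀ g : C(X, ℝ), (∀ x, 0 ≤ g x) → 0 ≤ Λ g) ∧
      Λ 1 = 1 ∧ ∀ g, Λ (L g) = r * Λ g := by
  set S : Set ℝ := {t | ∃ h : C(X, ℝ), (∀ x, 0 < h x) ∧ ∀ x, L h x ≤ t * h x} with hS
  have hSne : S.Nonempty := by
    refine ⟨‖L 1‖, 1, fun x => by simp, fun x => ?_⟩
    simpa using (le_abs_self _).trans ((L 1).norm_coe_le_norm x)
  have hSb : BddBelow S := by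
    refine ⟨0, ?_⟩
    rintro t ⟨h, hpos, hle⟩
    obtain ⟨x⟩ := ‹Nonempty X›
    have h1 := hL h (fun x => (hpos x).le) x
    have h2 := hle x
    have h3 := hpos x
    by_contra hneg
    push Not at hneg
    nlinarith
  set r := sInf S with hr
  have key : ∀ (h : C(X, ℝ)) (δ : ℝ), 0 < δ → ¬ ∀ x, L h x ≤ r * h x - δ := by
    intro h δ hδ hh
    have hn : ∀ x, |h x| ≤ ‖h‖ := fun x => h.norm_coe_le_norm x
    have hn0 : 0 ≤ ‖h‖ := norm_nonneg h
    have hε : 0 < δ / (‖h‖ + 1) := by positivity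
    have hεm : δ / (‖h‖ + 1) * (‖h‖ + 1) = δ := by field_simp
    set ε := δ / (‖h‖ + 1) with hεd
    obtain ⟨t, ⟨u, hu, hut⟩, htr⟩ := exists_lt_of_csInf_lt hSne (show sInf S < r + ε by linarith)
    have hrt : r ≤ t := csInf_le hSb ⟨u, hu, hut⟩
    obtain ⟨x0, -, hx0⟩ := isCompact_univ.exists_isMinOn (s := (Set.univ : Set X))
      Set.univ_nonempty (f := fun x => h x / u x)
      ((h.continuous.div u.continuous (fun x => (hu x).ne')).continuousOn)
    have hmin : ∀ x, h x0 / u x0 ≤ h x / u x := fun x => hx0 (Set.mem_univ x)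
    set q := h x0 / u x0 with hq
    have hqu : q * u x0 = h x0 := by
      rw [hq]; exact div_mul_cancel₀ _ (hu x0).ne'
    have hk : ∀ x, 0 ≤ (h - q • u) x := by
      intro x
      have := (le_div_iff₀ (hu x)).1 (hmin x)
      simpa using this
    have h1 := hL _ hk x0
    rw [map_sub, map_smul] at h1
    simp only [ContinuousMap.sub_apply, ContinuousMap.smul_apply, smul_eq_mul] at h1
    rcases le_or_gt q 0 with hq0 | hq0
    · have h2 : q * (t * u x0) ≤ q * L u x0 := mul_le_mul_of_nonpos_left (hut x0) hq0
      have h3 : q * (t * u x0) = t * h x0 := by rw [← hqu]; ring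
      have h4 := hh x0
      have h5 : (t - r) * (-h x0) ≤ (t - r) * ‖h‖ :=
        mul_le_mul_of_nonneg_left ((neg_le_abs _).trans (hn x0)) (by linarith)
      have h6 : (t - r) * ‖h‖ ≤ ε * ‖h‖ := mul_le_mul_of_nonneg_right (by linarith) hn0
      nlinarith
    · have hp : ∀ x, 0 < h x := by
        intro x
        have := (le_div_iff₀ (hu x)).1 (hmin x)
        have h2 := mul_pos hq0 (hu x)
        linarith
      have : r - ε ∈ S := by
        refine ⟨h, hp, fun x => ?_⟩
        have h2 := hh x
        have h3 : ε * h x ≤ ε * ‖h‖ :=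
          mul_le_mul_of_nonneg_left ((le_abs_self _).trans (hn x)) hε.le
        nlinarith
      have := csInf_le hSb this
      linarith
  let T : C(X, ℝ) →ₗ[ℝ] C(X, ℝ) := L - r • LinearMap.id
  have hT : ∀ h x, T h x = L h x - r * h x := fun h x => by simp [T]
  let s : Set C(X, ℝ) := {g | ∀ x, g x < 0}
  have hsc : Convex ℝ s := by
    intro a ha b hb p q hp hq hpq x
    have h1 := ha x
    have h2 := hb x
    simp only [ContinuousMap.add_apply, ContinuousMap.smul_apply, smul_eq_mul]
    rcases hp.eq_or_lt with h | h
    · have : q = 1 := by linarith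
      subst this; rw [← h]; linarith
    · have := mul_neg_of_pos_of_neg h h1
      have := mul_nonpos_of_nonneg_of_nonpos hq h2.le
      linarith
  have hso : IsOpen s := by
    have := ContinuousMap.isOpen_setOfPred_mapsTo (X := X) (Y := ℝ) isCompact_univ
      (isOpen_Iio (a := (0:ℝ)))
    convert this using 1
    ext g
    simp [s, Set.MapsTo]
  have hdisj : Disjoint s (LinearMap.range T : Set C(X, ℝ)) := by
    rw [Set.disjoint_left]
    rintro g hg ⟨h, rfl⟩
    obtain ⟨x0, -, hx0⟩ := isCompact_univ.exists_isMaxOn (s := (Set.univ : Set X))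
      Set.univ_nonempty (T h).continuous.continuousOn
    refine key h (-(T h x0)) (by have := hg x0; linarith) fun x => ?_
    have : T h x ≤ T h x0 := hx0 (Set.mem_univ x)
    have := hT h x
    linarith
  obtain ⟨F, u, hF1, hF2⟩ := geometric_hahn_banach_open hsc hso
    (Submodule.convex (LinearMap.range T)) hdisj
  have hu0 : u ≤ 0 := by simpa using hF2 0 (Submodule.zero_mem _)
  have hF3 : ∀ h, F (T h) = 0 := by
    intro h
    by_contra hne
    have := hF2 (T (((u - 1) / F (T h)) • h)) ⟨_, rfl⟩
    rw [map_smul, map_smul, smul_eq_mul, div_mul_cancel₀ _ hne] at this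
    linarith
  have hF4 : ∀ g : C(X, ℝ), (∀ x, 0 < g x) → 0 < F g := by
    intro g hg
    have := hF1 (-g) (fun x => by simpa using hg x)
    rw [map_neg] at this
    linarith
  have h1 : 0 < F 1 := hF4 1 (fun x => by simp)
  refine ⟨r, (F 1)⁻¹ • F.toLinearMap, ?_, ?_, ?_⟩
  · intro g hg
    have : 0 ≤ F g := by
      by_contra hneg
      push Not at hneg
      have := hF4 (g + (-(F g) / F 1) • 1) (fun x => by
        have := hg x
        have h2 : 0 < -(F g) / F 1 := div_pos (by linarith) h1
        simp only [ContinuousMap.add_apply, ContinuousMap.smul_apply, smul_eq_mul,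
          ContinuousMap.one_apply, mul_one]
        linarith)
      rw [map_add, map_smul, smul_eq_mul, div_mul_cancel₀ _ h1.ne'] at this
      linarith
    simp only [LinearMap.smul_apply, smul_eq_mul]
    exact mul_nonneg (inv_nonneg.2 h1.le) this
  · simp [h1.ne']
  · intro g
    have h2 := hF3 g
    have h3 : T g = L g - r • g := by simp [T]
    rw [h3, map_sub, map_smul, smul_eq_mul, sub_eq_zero] at h2
    simp [h2]
    ring

/-- A continuous open distance expanding map of a compact space is a covering map. -/
theorem covering_of_expanding {X : Type*} [MetricSpace X] [CompactSpace X]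
    (f : X → X) (hf : Continuous f) (hopen : IsOpenMap f) (hexp : DistanceExpanding f) :
    IsCoveringMap f := by
  rw [← isLocalHomeomorph_iff_isCoveringMap, isLocalHomeomorph_iff_isOpenEmbedding_restrict]
  obtain ⟨lam, hlam, η, hη, h⟩ := hexp
  intro x
  refine ⟨Metric.ball x (η / 2), Metric.ball_mem_nhds x (by positivity), ?_⟩
  refine Topology.IsOpenEmbedding.of_continuous_injective_isOpenMap
    (hf.comp continuous_subtype_val) ?_ (hopen.comp Metric.isOpen_ball.isOpenMap_subtype_val)
  rintro ⟨a, ha⟩ ⟨b, hb⟩ hab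
  have hab : f a = f b := hab
  have hd : dist a b ≤ η := by
    have := dist_triangle_right a b x
    rw [Metric.mem_ball] at ha hb
    linarith
  have h1 := h a b hd
  rw [hab, dist_self] at h1
  have : dist a b = 0 := by
    have := dist_nonneg (x := a) (y := b)
    nlinarith
  exact Subtype.ext (dist_eq_zero.1 this)

theorem fiber_finite {X : Type*} [MetricSpace X] [CompactSpace X]
    (f : X → X) (hf : Continuous f) (hc : IsCoveringMap f) (x : X) : Finite (f ⁻¹' {x}) := by
  have : CompactSpace (f ⁻¹' {x}) :=
    isCompact_iff_compactSpace.1 (isClosed_singleton.preimage hf).isCompact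
  have := (hc x).discreteTopology_fiber
  exact finite_of_compact_of_discrete

theorem transferOp_continuous {X : Type*} [MetricSpace X] [CompactSpace X]
    (f : X → X) (φ : X → ℝ) (hf : Continuous f) (hc : IsCoveringMap f) (hφ : Continuous φ)
    (g : X → ℝ) (hg : Continuous g) : Continuous (transferOp f φ g) := by
  rw [continuous_iff_continuousAt]
  intro x
  have := fiber_finite f hf hc x
  have := Fintype.ofFinite (f ⁻¹' {x})
  obtain ⟨-, U, hxU, hU, -, H, hH⟩ := hc x
  suffices h : ContinuousOn (transferOp f φ g) U from h.continuousAt (hU.mem_nhds hxU)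
  rw [continuousOn_iff_continuous_domRestrict]
  have key : U.domRestrict (transferOp f φ g) =
      fun z : U => ∑ i : (f ⁻¹' {x}), g (H.symm (z, i)) * Real.exp (φ (H.symm (z, i))) := by
    funext z
    have hz : ∀ i, f (H.symm (z, i)) = z := fun i => by rw [← hH]; simp
    let e : (f ⁻¹' {x}) ≃ (f ⁻¹' {(z : X)}) :=
      { toFun := fun i => ⟨H.symm (z, i), hz i⟩
        invFun := fun y => (H ⟨y, by
          have := y.2
          simp only [Set.mem_preimage, Set.mem_singleton_iff] at this ⊢
          rw [this]; exact z.2⟩).2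
        left_inv := fun i => by simp
        right_inv := fun y => by
          apply Subtype.ext
          have hy : f y ∈ U := by
            have := y.2
            simp only [Set.mem_preimage, Set.mem_singleton_iff] at this
            rw [this]; exact z.2
          have h1 : (z, (H ⟨y, hy⟩).2) = H ⟨y, hy⟩ := by
            refine Prod.ext (Subtype.ext ?_) rfl
            rw [hH]
            exact y.2.symm
          change ((H.symm (z, (H ⟨y, hy⟩).2) : f ⁻¹' U) : X) = y
          rw [h1, H.symm_apply_apply] }
    change ∑' y : (f ⁻¹' {(z : X)} : Set X), g y * Real.exp (φ y) = _
    rw [← e.tsum_eq, tsum_fintype]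
    rfl
  rw [key]
  fun_prop

theorem surjective_of_transitive {X : Type*} [MetricSpace X] [CompactSpace X] [Nonempty X]
    (f : X → X) (hf : Continuous f) (hopen : IsOpenMap f) (htrans : TopologicallyTransitive f) :
    Function.Surjective f := by
  rw [← Set.range_eq_univ]
  by_contra hne
  obtain ⟨z, ⟨y, hy, hyz⟩, hz⟩ := htrans (Set.range f) (Set.range f)ᶜ hopen.isOpen_range
    (isCompact_range hf).isClosed.isOpen_compl (Set.range_nonempty f)
    (Set.nonempty_compl.2 hne) |>.choose_spec
  apply hz
  rw [← hyz]
  generalize (Exists.choose _ : ℕ) = n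
  obtain ⟨w, rfl⟩ := hy
  rw [← Function.iterate_succ_apply, Function.iterate_succ_apply']
  exact ⟨_, rfl⟩

theorem HolderPotential.cont {X : Type*} [MetricSpace X] {φ : X → ℝ} (h : HolderPotential φ) :
    Continuous φ := by
  obtain ⟨C, hC, b, hb, h⟩ := h
  rw [continuous_iff_continuousAt]
  intro x
  rw [ContinuousAt, tendsto_iff_dist_tendsto_zero]
  refine squeeze_zero (fun _ => dist_nonneg) (fun y => h y x) ?_
  have h1 : Continuous fun y => C * dist y x ^ b :=
    continuous_const.mul ((continuous_id.dist continuous_const).rpow_const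
      (fun _ => Or.inr hb.1.le))
  have := h1.tendsto x
  simpa [Real.zero_rpow hb.1.ne'] using this

/-- **Existence of an eigen-measure of the dual transfer operator.** There exist
`lam > 0` and a Borel probability measure `m` with `∫ L_φ g dm = lam * ∫ g dm`
for every continuous `g`. -/
theorem dual_transfer_eigenmeasure_exists {X : Type*} [MetricSpace X] [CompactSpace X]
    [Nonempty X] [MeasurableSpace X] [BorelSpace X]
    (f : X → X) (φ : X → ℝ) (hf : Continuous f) (hopen : IsOpenMap f)
    (hexp : DistanceExpanding f) (htrans : TopologicallyTransitive f)
    (hφ : HolderPotential φ) :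
    ∃ lam > (0 : ℝ), ∃ m : Measure X, IsProbabilityMeasure m ∧
      ∀ g : X → ℝ, Continuous g →
        ∫ x, transferOp f φ g x ∂m = lam * ∫ x, g x ∂m := by
  have hφc := hφ.cont
  have hc := covering_of_expanding f hf hopen hexp
  have hfin := fiber_finite f hf hc
  have hsurj := surjective_of_transitive f hf hopen htrans
  let L : C(X, ℝ) →ₗ[ℝ] C(X, ℝ) :=
    { toFun := fun g => ⟨transferOp f φ g, transferOp_continuous f φ hf hc hφc g g.continuous⟩
      map_add' := fun a b => by
        ext x
        have := hfin x
        have := Fintype.ofFinite (f ⁻¹' {x})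
        simp [transferOp, tsum_fintype, add_mul, Finset.sum_add_distrib]
      map_smul' := fun c a => by
        ext x
        have := hfin x
        have := Fintype.ofFinite (f ⁻¹' {x})
        simp [transferOp, tsum_fintype, mul_assoc, Finset.mul_sum] }
  have hLa : ∀ g x, L g x = transferOp f φ g x := fun _ _ => rfl
  obtain ⟨r, Λ, hpos, hone, heig⟩ := positive_dual_eigen L (fun g hg x => by
    rw [hLa]
    exact tsum_nonneg fun y => mul_nonneg (hg y) (Real.exp_pos _).le)
  -- the eigenvalue is positive
  have hLpos : ∀ x, 0 < L 1 x := by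
    intro x
    have := hfin x
    have := Fintype.ofFinite (f ⁻¹' {x})
    obtain ⟨y, hy⟩ := hsurj x
    rw [hLa, transferOp, tsum_fintype]
    exact Finset.sum_pos (fun y _ => by simpa using Real.exp_pos _) ⟨⟨y, hy⟩, Finset.mem_univ _⟩
  have hr : 0 < r := by
    obtain ⟨x0, -, hx0⟩ := isCompact_univ.exists_isMinOn (s := (Set.univ : Set X))
      Set.univ_nonempty (L 1).continuous.continuousOn
    have h1 := hpos (L 1 - (L 1 x0) • 1) (fun x => by
      have : L 1 x0 ≤ L 1 x := hx0 (Set.mem_univ x)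
      simpa using this)
    rw [map_sub, map_smul, heig, hone, smul_eq_mul] at h1
    have := hLpos x0
    linarith
  let Λ' : CompactlySupportedContinuousMap X ℝ →ₚ[ℝ] ℝ := PositiveLinearMap.mk₀
    { toFun := fun g => Λ (g : C(X, ℝ))
      map_add' := fun a b => by
        rw [← map_add]; rfl
      map_smul' := fun c a => by
        rw [RingHom.id_apply, ← map_smul]; rfl } (fun g hg => hpos _ (fun x => hg x))
  have hint : ∀ g : C(X, ℝ), ∫ x, g x ∂(RealRMK.rieszMeasure Λ') = Λ g := fun g =>
    RealRMK.integral_rieszMeasure Λ'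
      ⟨g, HasCompactSupport.of_compactSpace g⟩
  refine ⟨r, hr, RealRMK.rieszMeasure Λ', ?_, ?_⟩
  · have h1 := hint 1
    rw [hone] at h1
    simp only [ContinuousMap.one_apply, integral_const, smul_eq_mul, mul_one] at h1
    constructor
    rw [measureReal_def] at h1
    exact (ENNReal.toReal_eq_one_iff _).1 h1
  · intro g hg
    have h1 := hint ⟨g, hg⟩
    have h2 := hint (L ⟨g, hg⟩)
    rw [heig] at h2
    rw [← h1] at h2
    exact h2
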